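/- Let k ≥ 5 be an odd integer and let 0 ≤ j ≤ k. Let S be the subdivided star with k arms, exactly j of which have 2 vertices and the remaining k−j of which have 1 vertex. Then the Grundy value of the 0.33 game on S is: 1 if j = 0; 2 if j = 1; 0 if j = 2; 3 if j = 3; and for j ≥ 4 it is 1 if j is even and 2 if j is odd. -/

import Mathlib

open SimpleGraph

/-- The minimum excludant of a set of naturals. -/
noncomputable def mex (A : Set ℕ) : ℕ := sInf {n : ℕ | n ∉ A}

/-- The connected component (as a vertex set) of `x` in the subgraph of `G`
induced on the vertex set `s`. -/
def compOf {V : Type} (G : SimpleGraph V) (s : Set V) (x : V) : Set V :=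
  {v | ∃ (hx : x ∈ s) (hv : v ∈ s), (G.induce s).Reachable ⟨x, hx⟩ ⟨v, hv⟩}

/-- A legal move of the 0.33 game on the graph `G`, from the position (vertex set) `s`
to the position `t`: one removes either a single vertex of `s`, or two vertices of `s`
that are adjacent in `G`, and the removed set may not disconnect the connected component
`H` (of the subgraph induced on `s`) containing it: `H` minus the removed set must be
connected or empty. -/
def ValidMove {V : Type} [DecidableEq V] (G : SimpleGraph V) (s t : Finset V) : Prop :=
  t ⊆ s ∧
  ((∃ x ∈ s, s \ t = {x}) ∨ (∃ x ∈ s, ∃ y ∈ s, G.Adj x y ∧ s \ t = {x, y})) ∧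
  ∀ x ∈ s \ t,
    (compOf G (↑s) x \ (↑(s \ t) : Set V) = ∅ ∨
     (G.induce (compOf G (↑s) x \ (↑(s \ t) : Set V))).Connected)

theorem ValidMove.card_lt {V : Type} [DecidableEq V] {G : SimpleGraph V} {s t : Finset V}
    (h : ValidMove G s t) : t.card < s.card := by
  apply Finset.card_lt_card
  rw [Finset.ssubset_iff_of_subset h.1]
  rcases h.2.1 with ⟨x, hx, he⟩ | ⟨x, hx, y, hy, _, he⟩
  · refine ⟨x, hx, fun hxt => ?_⟩
    have hmem : x ∈ s \ t := by rw [he]; exact Finset.mem_singleton_self x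
    exact (Finset.mem_sdiff.mp hmem).2 hxt
  · refine ⟨x, hx, fun hxt => ?_⟩
    have hmem : x ∈ s \ t := by rw [he]; simp
    exact (Finset.mem_sdiff.mp hmem).2 hxt

/-- The Grundy value of the 0.33 game on the graph `G` played on the vertex set `s`. -/
noncomputable def grundy {V : Type} [DecidableEq V] (G : SimpleGraph V) (s : Finset V) : ℕ :=
  mex {n : ℕ | ∃ t : {t : Finset V // ValidMove G s t}, grundy G t.1 = n}
termination_by s.card
decreasing_by exact t.2.card_lt

/-! ### Concrete graphs

`pathG` played on `Finset.range n` is the path `P_n`;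
`cycleG n` played on `Finset.range n` is the cycle `C_n`.

Subdivided stars and bistars are encoded on vertex type `ℕ × ℕ`.
A subdivided star is given by the list `L` of the numbers of vertices of its arms
(`some L`), or is the empty graph (`none`).
In the bistar `S₁ •m• S₂`, the center of `S₁` is `(0,0)`, the middle path consists of
`(1,1), …, (1,m)` where `(1,m)` is the center of `S₂` (when `m = 0` the two centers are
identified to `(0,0)`), the `i`-th arm of `S₁` consists of `(2i+2, 1), …, (2i+2, ℓᵢ)`,
and the `i`-th arm of `S₂` consists of `(2i+3, 1), …, (2i+3, ℓ'ᵢ)`.  If `S₂` is the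
empty graph, its center `(1,m)` is removed (so `S₁` just gets an extra arm with `m-1`
vertices), and similarly for `S₁`. -/

def pathG : SimpleGraph ℕ := SimpleGraph.fromRel (fun u v => v = u + 1)

def cycleG (n : ℕ) : SimpleGraph ℕ := SimpleGraph.fromRel (fun u v => v % n = (u + 1) % n)

def bistarG (m : ℕ) : SimpleGraph (ℕ × ℕ) :=
  SimpleGraph.fromRel (fun u v =>
    (u = (0, 0) ∧ v = (1, 1)) ∨
    (u.1 = 1 ∧ v.1 = 1 ∧ v.2 = u.2 + 1) ∨
    (u = (0, 0) ∧ 2 ≤ v.1 ∧ v.1 % 2 = 0 ∧ v.2 = 1) ∨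
    (u = (if m = 0 then ((0 : ℕ), (0 : ℕ)) else (1, m)) ∧ 3 ≤ v.1 ∧ v.1 % 2 = 1 ∧ v.2 = 1) ∨
    (u.1 = v.1 ∧ 2 ≤ u.1 ∧ v.2 = u.2 + 1))

def armVerts (base : ℕ) (L : List ℕ) : Finset (ℕ × ℕ) :=
  (Finset.range L.length).biUnion
    (fun i => (Finset.range (L.getD i 0)).image (fun j => (2 * i + base, j + 1)))

def bistarVerts (S1 S2 : Option (List ℕ)) (m : ℕ) : Finset (ℕ × ℕ) :=
  (match S1 with
   | none => (∅ : Finset (ℕ × ℕ))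
   | some L => insert ((0 : ℕ), (0 : ℕ)) (armVerts 2 L)) ∪
  (match S2 with
   | none => (Finset.range (m - 1)).image (fun p => ((1 : ℕ), p + 1))
   | some L => ((Finset.range m).image (fun p => ((1 : ℕ), p + 1))) ∪ armVerts 3 L)

/-- Grundy value of the 0.33 game on the subdivided bistar `S₁ •m• S₂`
(where `S₁`, `S₂` are subdivided stars or the empty graph). -/
noncomputable def bistarGrundyO (S1 S2 : Option (List ℕ)) (m : ℕ) : ℕ :=
  grundy (bistarG m) (bistarVerts S1 S2 m)

/-- Grundy value of the 0.33 game on the subdivided bistar `S_{L₁} •m• S_{L₂}`. -/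
noncomputable def bistarGrundy (L1 L2 : List ℕ) (m : ℕ) : ℕ :=
  bistarGrundyO (some L1) (some L2) m

/-- Grundy value of the 0.33 game on the subdivided star `S_L`. -/
noncomputable def starGrundy (L : List ℕ) : ℕ := bistarGrundy L [] 0

/-- Grundy value of the 0.33 game on a subdivided star or the empty graph. -/
noncomputable def starGrundyO (S : Option (List ℕ)) : ℕ := bistarGrundyO S (some []) 0

theorem mex_eq {A : Set ℕ} {n : ℕ} (hn : n ∉ A) (h : ∀ m < n, m ∈ A) : mex A = n :=
  le_antisymm (Nat.sInf_le hn) (le_csInf ⟨n, hn⟩ fun m hm => not_lt.1 fun hlt => hm (h m hlt))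

section General

variable {V : Type} {G : SimpleGraph V} {s t : Finset V}

/-- The vertex set `s` is empty or induces a connected subgraph of `G`. -/
def EmptyOrConnected (G : SimpleGraph V) (s : Finset V) : Prop :=
  s = ∅ ∨ (G.induce (s : Set V)).Connected

theorem emptyOrConnected_of_reachable (c : V) (hc : c ∈ s)
    (h : ∀ v (hv : v ∈ s), (G.induce (s : Set V)).Reachable ⟨c, hc⟩ ⟨v, hv⟩) :
    EmptyOrConnected G s :=
  Or.inr ((connected_iff_exists_forall_reachable _).2 ⟨⟨c, hc⟩, fun v => h v.1 v.2⟩)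

theorem emptyOrConnected_singleton (c : V) : EmptyOrConnected G {c} := by
  refine emptyOrConnected_of_reachable c (by simp) fun v hv => ?_
  obtain rfl : v = c := by simpa using hv
  rfl

/-- A property that spreads along the edges of a connected set holds on all of it. -/
theorem EmptyOrConnected.induction (hs : EmptyOrConnected G s) {P : V → Prop}
    (hP : ∀ u ∈ s, ∀ v ∈ s, G.Adj u v → P u → P v) {x y : V} (hx : x ∈ s) (hy : y ∈ s)
    (hPx : P x) : P y := by
  rcases hs with rfl | hs
  · simp at hx
  · obtain ⟨w⟩ := hs.preconnected ⟨x, hx⟩ ⟨y, hy⟩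
    suffices H : ∀ (a b : (s : Set V)), (G.induce (s : Set V)).Walk a b → P a → P b from
      H _ _ w hPx
    intro a b w
    induction w with
    | nil => exact id
    | cons hadj _ ih => exact fun ha => ih (hP _ (Subtype.coe_prop _) _ (Subtype.coe_prop _) hadj ha)

variable [DecidableEq V]

theorem grundy_eq {n : ℕ} (hne : ∀ t, ValidMove G s t → grundy G t ≠ n)
    (hex : ∀ m < n, ∃ t, ValidMove G s t ∧ grundy G t = m) : grundy G s = n := by
  rw [grundy]
  refine mex_eq ?_ ?_
  · rintro ⟨⟨t, ht⟩, h⟩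
    exact hne t ht h
  · intro m hm
    obtain ⟨t, ht, h⟩ := hex m hm
    exact ⟨⟨t, ht⟩, h⟩

theorem EmptyOrConnected.validMove_iff (hs : EmptyOrConnected G s) :
    ValidMove G s t ↔ t ⊆ s ∧
      ((∃ x ∈ s, s \ t = {x}) ∨ (∃ x ∈ s, ∃ y ∈ s, G.Adj x y ∧ s \ t = {x, y})) ∧
      EmptyOrConnected G t := by
  refine and_congr_right fun hts => and_congr_right fun hrem => ?_
  have key : ∀ x ∈ s \ t, compOf G (↑s) x \ (↑(s \ t) : Set V) = ↑t := by
    intro x hx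
    have hxs : x ∈ s := (Finset.mem_sdiff.1 hx).1
    have hcomp : compOf G (↑s) x = ↑s := by
      ext v
      constructor
      · rintro ⟨-, hv, -⟩
        exact hv
      · intro hv
        rcases hs with rfl | hs
        · simp at hxs
        · exact ⟨hxs, hv, hs.preconnected _ _⟩
    rw [hcomp]
    ext v
    have := @hts v
    simp only [Set.mem_sdiff, Finset.mem_coe, Finset.mem_sdiff]
    tauto
  have hne : (s \ t).Nonempty := by
    rcases hrem with ⟨x, -, h⟩ | ⟨x, -, y, -, -, h⟩ <;> simp [h]
  constructor
  · intro h
    obtain ⟨x, hx⟩ := hne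
    have := h x hx
    rw [key x hx] at this
    simpa [EmptyOrConnected] using this
  · intro h x hx
    rw [key x hx]
    simpa [EmptyOrConnected] using h

theorem EmptyOrConnected.validMove_of_insert (hs : EmptyOrConnected G s)
    (ht : EmptyOrConnected G t) {x : V} (hx : x ∉ t) (h : s = insert x t) : ValidMove G s t := by
  subst h
  refine hs.validMove_iff.2 ⟨Finset.subset_insert _ _, Or.inl ⟨x, by simp, ?_⟩, ht⟩
  ext v
  simp only [Finset.mem_sdiff, Finset.mem_insert, Finset.mem_singleton]
  grind

theorem EmptyOrConnected.validMove_of_insert_insert (hs : EmptyOrConnected G s)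
    (ht : EmptyOrConnected G t) {x y : V} (hx : x ∉ t) (hy : y ∉ t) (hxy : G.Adj x y)
    (h : s = insert x (insert y t)) : ValidMove G s t := by
  subst h
  refine hs.validMove_iff.2 ⟨fun v hv => by simp [hv], Or.inr ⟨x, by simp, y, by simp, hxy, ?_⟩, ht⟩
  ext v
  simp only [Finset.mem_sdiff, Finset.mem_insert, Finset.mem_singleton]
  grind

theorem ValidMove.card_eq (h : ValidMove G s t) : t.card + 1 = s.card ∨ t.card + 2 = s.card := by
  have hcard := Finset.card_sdiff_add_card_eq_card h.1
  rcases h.2.1 with ⟨x, -, hx⟩ | ⟨x, -, y, -, hadj, hx⟩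
  · rw [hx, Finset.card_singleton] at hcard
    omega
  · rw [hx, Finset.card_pair hadj.ne] at hcard
    omega

/-- The Grundy value is the number of vertices modulo three when it is always possible to remove
one vertex, and to remove two vertices. -/
theorem grundy_eq_card_mod_three (F : Finset V → Prop)
    (hmove : ∀ s t, F s → ValidMove G s t → F t)
    (hone : ∀ s, F s → 1 ≤ s.card → ∃ t, ValidMove G s t ∧ t.card + 1 = s.card)
    (htwo : ∀ s, F s → 2 ≤ s.card → ∃ t, ValidMove G s t ∧ t.card + 2 = s.card)
    (s : Finset V) (hs : F s) : grundy G s = s.card % 3 := by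
  induction hn : s.card using Nat.strong_induction_on generalizing s with
  | _ n ih =>
    subst hn
    refine grundy_eq ?_ ?_
    · intro t ht
      rw [ih _ ht.card_lt t (hmove s t hs ht) rfl]
      have := ht.card_eq
      omega
    · intro m hm
      have : m = (s.card - 1) % 3 ∨ (2 ≤ s.card ∧ m = (s.card - 2) % 3) := by omega
      rcases this with h | ⟨h2, h⟩
      · obtain ⟨t, ht, hc⟩ := hone s hs (by omega)
        refine ⟨t, ht, ?_⟩
        rw [ih _ ht.card_lt t (hmove s t hs ht) rfl, h, ← hc, Nat.add_sub_cancel]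
      · obtain ⟨t, ht, hc⟩ := htwo s hs h2
        refine ⟨t, ht, ?_⟩
        rw [ih _ ht.card_lt t (hmove s t hs ht) rfl, h, ← hc, Nat.add_sub_cancel]

end General

/-- The vertices of the subdivided star whose arms have two vertices at the indices in `A` and
one vertex at the indices in `B`. -/
def starVerts (A B : Finset ℕ) : Finset (ℕ × ℕ) :=
  insert (0, 0) ((A ∪ B).image (fun i => (2 * i + 2, 1)) ∪ A.image (fun i => (2 * i + 2, 2)))

theorem mem_starVerts {A B : Finset ℕ} {v : ℕ × ℕ} :
    v ∈ starVerts A B ↔ v = (0, 0) ∨ (∃ i ∈ A ∪ B, v = (2 * i + 2, 1)) ∨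
      ∃ i ∈ A, v = (2 * i + 2, 2) := by
  simp only [starVerts, Finset.mem_insert, Finset.mem_union, Finset.mem_image, eq_comm (a := v)]

@[simp] theorem center_mem_starVerts (A B : Finset ℕ) : (0, 0) ∈ starVerts A B := by
  simp [mem_starVerts]

@[simp] theorem inner_mem_starVerts {A B : Finset ℕ} {i : ℕ} :
    (2 * i + 2, 1) ∈ starVerts A B ↔ i ∈ A ∪ B := by
  simp [mem_starVerts]

@[simp] theorem outer_mem_starVerts {A B : Finset ℕ} {i : ℕ} :
    (2 * i + 2, 2) ∈ starVerts A B ↔ i ∈ A := by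
  simp [mem_starVerts]

theorem card_starVerts {A B : Finset ℕ} (h : Disjoint A B) :
    (starVerts A B).card = 1 + 2 * A.card + B.card := by
  rw [starVerts, Finset.card_insert_of_notMem (by simp), Finset.card_union_of_disjoint,
    Finset.card_image_of_injective, Finset.card_image_of_injective, Finset.card_union_of_disjoint h]
  · ring
  · intro i j hij
    simpa using hij
  · intro i j hij
    simpa using hij
  · simp [Finset.disjoint_left]

theorem bistarG_adj_center (i : ℕ) : (bistarG 0).Adj (0, 0) (2 * i + 2, 1) := by
  simp [bistarG]

theorem bistarG_adj_arm (i : ℕ) : (bistarG 0).Adj (2 * i + 2, 1) (2 * i + 2, 2) := by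
  simp [bistarG]

theorem adj_cases {A B : Finset ℕ} {u v : ℕ × ℕ} (hu : u ∈ starVerts A B)
    (hv : v ∈ starVerts A B) (h : (bistarG 0).Adj u v) :
    u = (0, 0) ∨ v = (0, 0) ∨ ∃ i, (u = (2 * i + 2, 1) ∧ v = (2 * i + 2, 2)) ∨
      (u = (2 * i + 2, 2) ∧ v = (2 * i + 2, 1)) := by
  rw [mem_starVerts] at hu hv
  rcases hu with rfl | ⟨i, -, rfl⟩ | ⟨i, -, rfl⟩ <;>
    rcases hv with rfl | ⟨j, -, rfl⟩ | ⟨j, -, rfl⟩ <;>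
    simp [bistarG] at h ⊢ <;> omega

theorem not_adj_center_outer (i : ℕ) : ¬ (bistarG 0).Adj (0, 0) (2 * i + 2, 2) := by
  simp [bistarG]

theorem emptyOrConnected_starVerts (A B : Finset ℕ) :
    EmptyOrConnected (bistarG 0) (starVerts A B) := by
  have hin : ∀ i (hi : (2 * i + 2, 1) ∈ starVerts A B),
      ((bistarG 0).induce (starVerts A B : Set (ℕ × ℕ))).Reachable
        ⟨(0, 0), center_mem_starVerts A B⟩ ⟨_, hi⟩ :=
    fun i hi => Adj.reachable (bistarG_adj_center i)
  refine emptyOrConnected_of_reachable (0, 0) (center_mem_starVerts A B) fun v hv => ?_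
  obtain rfl | ⟨i, -, rfl⟩ | ⟨i, hi, rfl⟩ := mem_starVerts.1 hv
  · rfl
  · exact hin i hv
  · have hi1 : (2 * i + 2, 1) ∈ starVerts A B := by simp [hi]
    exact (hin i hi1).trans (Adj.reachable (bistarG_adj_arm i))

section Substar

variable {A B : Finset ℕ} {t : Finset (ℕ × ℕ)}

theorem inner_mem_of_outer_mem (ht : EmptyOrConnected (bistarG 0) t) (hsub : t ⊆ starVerts A B)
    (hc : (0, 0) ∈ t) {i : ℕ} (hi : (2 * i + 2, 2) ∈ t) : (2 * i + 2, 1) ∈ t := by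
  by_contra hcon
  have := ht.induction (P := fun u => u = (2 * i + 2, 2)) ?_ hi hc rfl
  · simp at this
  · rintro u hu v hv hadj rfl
    rcases adj_cases (hsub hu) (hsub hv) hadj with h | rfl | ⟨j, ⟨h, rfl⟩ | ⟨h, rfl⟩⟩
    · simp at h
    · exact absurd hadj.symm (not_adj_center_outer i)
    · simp at h
    · obtain rfl : i = j := by simpa using h
      exact absurd hv hcon

theorem eq_starVerts_of_center_mem (ht : EmptyOrConnected (bistarG 0) t)
    (hsub : t ⊆ starVerts A B) (hc : (0, 0) ∈ t) :
    ∃ A' B', Disjoint A' B' ∧ A' ∪ B' ⊆ A ∪ B ∧ t = starVerts A' B' := by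
  refine ⟨A.filter fun i => (2 * i + 2, 2) ∈ t,
    (A ∪ B).filter fun i => (2 * i + 2, 1) ∈ t ∧ (2 * i + 2, 2) ∉ t, ?_, ?_, ?_⟩
  · rw [Finset.disjoint_left]
    intro i
    simp only [Finset.mem_filter]
    tauto
  · intro i
    simp only [Finset.mem_union, Finset.mem_filter]
    tauto
  · ext v
    constructor
    · intro hv
      obtain rfl | ⟨i, hi, rfl⟩ | ⟨i, hi, rfl⟩ := mem_starVerts.1 (hsub hv)
      · simp
      · simp only [inner_mem_starVerts, Finset.mem_union, Finset.mem_filter] at hi ⊢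
        have : (2 * i + 2, 2) ∈ t → i ∈ A := fun h => by simpa using hsub h
        tauto
      · simpa using ⟨hi, hv⟩
    · intro hv
      obtain rfl | ⟨i, hi, rfl⟩ | ⟨i, hi, rfl⟩ := mem_starVerts.1 hv
      · exact hc
      · simp only [Finset.mem_union, Finset.mem_filter] at hi
        rcases hi with ⟨-, hi⟩ | ⟨-, hi, -⟩
        · exact inner_mem_of_outer_mem ht hsub hc hi
        · exact hi
      · exact (Finset.mem_filter.1 hi).2

theorem subset_arm_of_center_notMem (ht : EmptyOrConnected (bistarG 0) t)
    (hsub : t ⊆ starVerts A B) (hc : (0, 0) ∉ t) :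
    ∃ i, t ⊆ {(2 * i + 2, 1), (2 * i + 2, 2)} := by
  rcases t.eq_empty_or_nonempty with rfl | ⟨x, hx⟩
  · exact ⟨0, by simp⟩
  obtain ⟨i, hxi⟩ : ∃ i, x.1 = 2 * i + 2 := by
    obtain rfl | ⟨i, -, rfl⟩ | ⟨i, -, rfl⟩ := mem_starVerts.1 (hsub hx)
    · exact absurd hx hc
    · exact ⟨i, rfl⟩
    · exact ⟨i, rfl⟩
  refine ⟨i, fun y hy => ?_⟩
  have hyi := ht.induction (P := fun u => u.1 = 2 * i + 2) ?_ hx hy hxi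
  · obtain rfl | ⟨j, -, rfl⟩ | ⟨j, -, rfl⟩ := mem_starVerts.1 (hsub hy) <;> simp at hyi <;>
      simp [hyi]
  · intro u hu v hv hadj h
    rcases adj_cases (hsub hu) (hsub hv) hadj with rfl | rfl | ⟨j, ⟨rfl, rfl⟩ | ⟨rfl, rfl⟩⟩
    · exact absurd hu hc
    · exact absurd hv hc
    · exact h
    · exact h

end Substar

section Moves

variable {A B : Finset ℕ} {i : ℕ}

theorem validMove_remove_short (hAB : Disjoint A B) (hi : i ∈ B) :
    ValidMove (bistarG 0) (starVerts A B) (starVerts A (B.erase i)) := by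
  have hiA := Finset.disjoint_right.1 hAB hi
  refine (emptyOrConnected_starVerts _ _).validMove_of_insert (emptyOrConnected_starVerts _ _)
    (x := (2 * i + 2, 1)) (by simp [hiA]) ?_
  ext ⟨p, q⟩
  simp only [mem_starVerts, Finset.mem_insert, Finset.mem_union, Finset.mem_erase, Prod.mk.injEq]
  grind

theorem validMove_shorten_long (hi : i ∈ A) :
    ValidMove (bistarG 0) (starVerts A B) (starVerts (A.erase i) (insert i B)) := by
  refine (emptyOrConnected_starVerts _ _).validMove_of_insert (emptyOrConnected_starVerts _ _)
    (x := (2 * i + 2, 2)) (by simp) ?_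
  ext ⟨p, q⟩
  simp only [mem_starVerts, Finset.mem_insert, Finset.mem_union, Finset.mem_erase, Prod.mk.injEq]
  grind

theorem validMove_remove_long (hAB : Disjoint A B) (hi : i ∈ A) :
    ValidMove (bistarG 0) (starVerts A B) (starVerts (A.erase i) B) := by
  have hiB := Finset.disjoint_left.1 hAB hi
  refine (emptyOrConnected_starVerts _ _).validMove_of_insert_insert
    (emptyOrConnected_starVerts _ _) (x := (2 * i + 2, 1)) (y := (2 * i + 2, 2)) (by simp [hiB])
    (by simp) (bistarG_adj_arm i) ?_
  ext ⟨p, q⟩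
  simp only [mem_starVerts, Finset.mem_insert, Finset.mem_union, Finset.mem_erase, Prod.mk.injEq]
  grind

/-- With at least three arms, every move takes place inside one arm. -/
theorem ValidMove.starVerts_cases (hAB : Disjoint A B) (hcard : 3 ≤ A.card + B.card)
    {t : Finset (ℕ × ℕ)} (h : ValidMove (bistarG 0) (starVerts A B) t) :
    (∃ i ∈ B, t = starVerts A (B.erase i)) ∨
    (∃ i ∈ A, t = starVerts (A.erase i) (insert i B)) ∨
    ∃ i ∈ A, t = starVerts (A.erase i) B := by
  have hle := h.card_eq
  obtain ⟨hsub, hrem, hconn⟩ := (emptyOrConnected_starVerts A B).validMove_iff.1 h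
  have hc : (0, 0) ∈ t := by
    by_contra hc
    obtain ⟨i, hi⟩ := subset_arm_of_center_notMem hconn hsub hc
    have hT : insert (0, 0) (((A ∪ B).erase i).image fun j => (2 * j + 2, 1)) ⊆
        starVerts A B \ t := by
      intro v hv
      simp only [Finset.mem_insert, Finset.mem_image] at hv
      rcases hv with rfl | ⟨j, hj, rfl⟩
      · simpa using hc
      · rw [Finset.mem_erase] at hj
        refine Finset.mem_sdiff.2 ⟨by simpa using hj.2, fun hjt => ?_⟩
        have := hi hjt
        simp [hj.1] at this
    have hcT := Finset.card_le_card hT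
    rw [Finset.card_insert_of_notMem (by simp),
      Finset.card_image_of_injective _ (fun a b hab => by simpa using hab)] at hcT
    have h1 := Finset.pred_card_le_card_erase (s := A ∪ B) (a := i)
    rw [Finset.card_union_of_disjoint hAB] at h1
    have h2 := Finset.card_sdiff_add_card_eq_card hsub
    omega
  have hout := fun i => inner_mem_of_outer_mem hconn hsub hc (i := i)
  have hrec : ∀ v, v ∈ t ↔ v ∈ starVerts A B ∧ v ∉ starVerts A B \ t := by
    intro v
    have := @hsub v
    rw [Finset.mem_sdiff]
    tauto
  rcases hrem with ⟨x, hx, hxt⟩ | ⟨x, hx, y, hy, hadj, hxt⟩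
  · rw [hxt] at hrec
    obtain rfl | ⟨i, hi, rfl⟩ | ⟨i, hi, rfl⟩ := mem_starVerts.1 hx
    · simp [hrec] at hc
    · have hiA : i ∉ A := by
        intro hiA
        have := hout i
        simp [hrec, hiA] at this
      left
      refine ⟨i, by simpa [hiA] using hi, ?_⟩
      ext ⟨p, q⟩
      simp only [hrec, mem_starVerts, Finset.mem_singleton, Finset.mem_union, Finset.mem_erase,
        Prod.mk.injEq]
      grind
    · right; left
      refine ⟨i, hi, ?_⟩
      ext ⟨p, q⟩
      simp only [hrec, mem_starVerts, Finset.mem_singleton, Finset.mem_union, Finset.mem_erase,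
        Finset.mem_insert, Prod.mk.injEq]
      grind
  · rw [hxt] at hrec
    obtain ⟨i, hi⟩ : ∃ i, ({x, y} : Finset (ℕ × ℕ)) = {(2 * i + 2, 1), (2 * i + 2, 2)} := by
      rcases adj_cases hx hy hadj with rfl | rfl | ⟨i, ⟨rfl, rfl⟩ | ⟨rfl, rfl⟩⟩
      · simp [hrec] at hc
      · simp [hrec] at hc
      · exact ⟨i, rfl⟩
      · exact ⟨i, Finset.pair_comm _ _⟩
    rw [hi] at hrec hxt
    have hiA : i ∈ A := by
      have : (2 * i + 2, 2) ∈ starVerts A B \ t := by simp [hxt]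
      simpa using (Finset.mem_sdiff.1 this).1
    have hiB := Finset.disjoint_left.1 hAB hiA
    right; right
    refine ⟨i, hiA, ?_⟩
    ext ⟨p, q⟩
    simp only [hrec, mem_starVerts, Finset.mem_singleton, Finset.mem_union, Finset.mem_erase,
      Finset.mem_insert, Prod.mk.injEq]
    grind

end Moves

/-- A subdivided star with at most two arms is a path. -/
theorem grundy_starVerts_of_card_le_two {A B : Finset ℕ} (hAB : Disjoint A B)
    (hcard : A.card + B.card ≤ 2) :
    grundy (bistarG 0) (starVerts A B) = (1 + 2 * A.card + B.card) % 3 := by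
  rw [← card_starVerts hAB]
  have hU : (A ∪ B).card ≤ 2 := (Finset.card_union_le A B).trans hcard
  have hstep : ∀ s, EmptyOrConnected (bistarG 0) s ∧ s ⊆ starVerts A B → 1 ≤ s.card →
      (∃ t, ValidMove (bistarG 0) s t ∧ t.card + 1 = s.card) ∧
      (2 ≤ s.card → ∃ t, ValidMove (bistarG 0) s t ∧ t.card + 2 = s.card) := by
    rintro s ⟨hs, hsub⟩ hpos
    by_cases hc : (0, 0) ∈ s
    · obtain ⟨A', B', hdis, hunion, rfl⟩ := eq_starVerts_of_center_mem hs hsub hc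
      have hle := (Finset.card_le_card hunion).trans hU
      rw [Finset.card_union_of_disjoint hdis] at hle
      rcases A'.eq_empty_or_nonempty with rfl | ⟨i, hi⟩
      · rcases B'.eq_empty_or_nonempty with rfl | ⟨i, hi⟩
        · refine ⟨⟨∅, hs.validMove_of_insert (Or.inl rfl) (x := (0, 0)) (by simp) ?_, ?_⟩,
            fun h => ?_⟩
          · simp [starVerts]
          · simp [starVerts]
          · simp [starVerts] at h
        · refine ⟨⟨_, validMove_remove_short hdis hi, ?_⟩, fun _ =>
            ⟨(B'.erase i).image fun j => (2 * j + 2, 1), hs.validMove_of_insert_insert ?_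
              (by simp) (by simp) (bistarG_adj_center i) ?_, ?_⟩⟩
          · rw [card_starVerts hdis, card_starVerts (by simp), ← Finset.card_erase_add_one hi]
            omega
          · have : (B'.erase i).card ≤ 1 := by
              have := Finset.card_erase_add_one hi
              simp at hle
              omega
            obtain ⟨j, hj⟩ := Finset.card_le_one_iff_subset_singleton.1 this
            rcases Finset.subset_singleton_iff.1 hj with h | h <;> rw [h]
            · exact Or.inl rfl
            · exact emptyOrConnected_singleton _
          · ext ⟨p, q⟩
            simp only [mem_starVerts, Finset.mem_insert, Finset.mem_union, Finset.mem_erase,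
              Finset.mem_image, Prod.mk.injEq]
            grind
          · rw [card_starVerts hdis, Finset.card_image_of_injective _
              (fun a b hab => by simpa using hab), ← Finset.card_erase_add_one hi]
            simp
            omega
      · have hiB := Finset.disjoint_left.1 hdis hi
        have hA := Finset.card_erase_add_one hi
        have hd : Disjoint (A'.erase i) B' := hdis.mono_left (Finset.erase_subset _ _)
        refine ⟨⟨_, validMove_shorten_long hi, ?_⟩, fun _ =>
          ⟨_, validMove_remove_long hdis hi, ?_⟩⟩
        · rw [card_starVerts hdis, card_starVerts (by simpa using hd),
            Finset.card_insert_of_notMem hiB]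
          omega
        · rw [card_starVerts hdis, card_starVerts hd]
          omega
    · obtain ⟨i, hi⟩ := subset_arm_of_center_notMem hs hsub hc
      have hcases : s = {(2 * i + 2, 1)} ∨ s = {(2 * i + 2, 2)} ∨
          s = {(2 * i + 2, 1), (2 * i + 2, 2)} := by
        obtain ⟨x, hx⟩ := Finset.card_pos.1 hpos
        have hi' := fun v (hv : v ∈ s) => Finset.mem_insert.1 (hi hv)
        simp only [Finset.mem_singleton] at hi'
        have := hi' x hx
        simp only [Finset.ext_iff, Finset.mem_insert, Finset.mem_singleton]
        grind
      rcases hcases with rfl | rfl | rfl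
      · exact ⟨⟨∅, hs.validMove_of_insert (Or.inl rfl) (by simp) rfl, by simp⟩, by simp⟩
      · exact ⟨⟨∅, hs.validMove_of_insert (Or.inl rfl) (by simp) rfl, by simp⟩, by simp⟩
      · exact ⟨⟨_, hs.validMove_of_insert (emptyOrConnected_singleton _) (by simp) rfl, by simp⟩,
          fun _ => ⟨∅, hs.validMove_of_insert_insert (Or.inl rfl) (by simp) (by simp)
            (bistarG_adj_arm i) rfl, by simp⟩⟩
  refine grundy_eq_card_mod_three
    (fun s => EmptyOrConnected (bistarG 0) s ∧ s ⊆ starVerts A B) ?_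
    (fun s hs h => (hstep s hs h).1) (fun s hs h => (hstep s hs (by omega)).2 h) _
    ⟨emptyOrConnected_starVerts A B, subset_rfl⟩
  rintro s t ⟨hs, hsub⟩ h
  obtain ⟨hts, -, ht⟩ := hs.validMove_iff.1 h
  exact ⟨ht, hts.trans hsub⟩

/-- The Grundy value of the subdivided star with `a` arms of two vertices and `b` arms of one
vertex. -/
def starValue (a b : ℕ) : ℕ :=
  if a + b ≤ 2 then (1 + 2 * a + b) % 3
  else if a = 3 ∧ b = 0 then 1
  else if (a + b) % 2 = 1 then
    if a = 0 then 1 else if a = 1 then 2 else if a = 2 then 0 else if a = 3 then 3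
    else if a % 2 = 0 then 1 else 2
  else
    if a = 0 then 0 else if a = 1 then 3 else if a = 2 then 1 else if a = 3 then 2
    else if a % 2 = 0 then 0 else 3

theorem starValue_remove_short_ne {a b : ℕ} (h : 3 ≤ a + b + 1) :
    starValue a b ≠ starValue a (b + 1) := by
  unfold starValue
  grind (splits := 20)

theorem starValue_shorten_long_ne {a b : ℕ} (h : 3 ≤ a + 1 + b) :
    starValue a (b + 1) ≠ starValue (a + 1) b := by
  unfold starValue
  grind (splits := 20)

theorem starValue_remove_long_ne {a b : ℕ} (h : 3 ≤ a + 1 + b) :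
    starValue a b ≠ starValue (a + 1) b := by
  unfold starValue
  grind (splits := 20)

theorem exists_option_of_lt_starValue {a b m : ℕ} (h : 3 ≤ a + b) (hm : m < starValue a b) :
    (1 ≤ b ∧ starValue a (b - 1) = m) ∨ (1 ≤ a ∧ starValue (a - 1) (b + 1) = m) ∨
      (1 ≤ a ∧ starValue (a - 1) b = m) := by
  unfold starValue at *
  grind (splits := 60)

theorem grundy_starVerts {A B : Finset ℕ} (hAB : Disjoint A B) :
    grundy (bistarG 0) (starVerts A B) = starValue A.card B.card := by
  induction hn : 2 * A.card + B.card using Nat.strong_induction_on generalizing A B with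
  | _ n ih =>
    by_cases hcard : A.card + B.card ≤ 2
    · rw [grundy_starVerts_of_card_le_two hAB hcard, starValue, if_pos hcard]
    rw [not_le] at hcard
    have hshort : ∀ i ∈ B, grundy (bistarG 0) (starVerts A (B.erase i)) =
        starValue A.card (B.card - 1) := by
      intro i hi
      have := Finset.card_erase_add_one hi
      rw [ih _ (by omega) (hAB.mono_right (Finset.erase_subset _ _)) rfl,
        Finset.card_erase_of_mem hi]
    have hshorten : ∀ i ∈ A, grundy (bistarG 0) (starVerts (A.erase i) (insert i B)) =
        starValue (A.card - 1) (B.card + 1) := by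
      intro i hi
      have h1 := Finset.card_erase_add_one hi
      have h2 := Finset.card_insert_of_notMem (Finset.disjoint_left.1 hAB hi)
      rw [ih _ (by omega) (by simpa using hAB.mono_left (Finset.erase_subset _ _)) rfl,
        Finset.card_erase_of_mem hi, h2]
    have hlong : ∀ i ∈ A, grundy (bistarG 0) (starVerts (A.erase i) B) =
        starValue (A.card - 1) B.card := by
      intro i hi
      have h1 := Finset.card_erase_add_one hi
      rw [ih _ (by omega) (hAB.mono_left (Finset.erase_subset _ _)) rfl,
        Finset.card_erase_of_mem hi]
    refine grundy_eq ?_ ?_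
    · intro t ht
      rcases ht.starVerts_cases hAB hcard with ⟨i, hi, rfl⟩ | ⟨i, hi, rfl⟩ | ⟨i, hi, rfl⟩
      · have := Finset.card_erase_add_one hi
        rw [hshort i hi, ← this]
        exact starValue_remove_short_ne (by omega)
      · have := Finset.card_erase_add_one hi
        rw [hshorten i hi, ← this]
        exact starValue_shorten_long_ne (by omega)
      · have := Finset.card_erase_add_one hi
        rw [hlong i hi, ← this]
        exact starValue_remove_long_ne (by omega)
    · intro m hm
      rcases exists_option_of_lt_starValue hcard hm with ⟨h, rfl⟩ | ⟨h, rfl⟩ | ⟨h, rfl⟩ <;>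
        obtain ⟨i, hi⟩ := Finset.card_pos.1 h
      · exact ⟨_, validMove_remove_short hAB hi, hshort i hi⟩
      · exact ⟨_, validMove_shorten_long hi, hshorten i hi⟩
      · exact ⟨_, validMove_remove_long hAB hi, hlong i hi⟩

theorem bistarVerts_replicate {k j : ℕ} (hj : j ≤ k) :
    bistarVerts (some (List.replicate j 2 ++ List.replicate (k - j) 1)) (some []) 0 =
      starVerts (Finset.range j) (Finset.Ico j k) := by
  have hget : ∀ i, (List.replicate j 2 ++ List.replicate (k - j) 1).getD i 0 =
      if i < j then 2 else if i < k then 1 else 0 := by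
    intro i
    simp only [List.getD_eq_getElem?_getD, List.getElem?_append, List.getElem?_replicate,
      List.length_replicate]
    grind
  ext ⟨p, q⟩
  simp only [bistarVerts, armVerts, mem_starVerts, hget, Finset.mem_union, Finset.mem_insert,
    Finset.mem_biUnion, Finset.mem_image, Finset.mem_range, Finset.mem_Ico, Prod.mk.injEq,
    List.length_append, List.length_replicate, List.length_nil]
  constructor
  · grind
  · rintro (h | ⟨i, hi, rfl, rfl⟩ | ⟨i, hi, rfl, rfl⟩)
    · simp [h]
    · exact Or.inl (Or.inr ⟨i, by omega, 0, by grind, rfl, rfl⟩)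
    · exact Or.inl (Or.inr ⟨i, by omega, 1, by grind, rfl, rfl⟩)

/-- Grundy values of the 0.33 game on stars with an odd number `k ≥ 5` of arms,
`j` of which have 2 vertices and `k - j` of which have 1 vertex. -/
theorem grundy_star_odd_arms (k j : ℕ) (hk : 5 ≤ k) (hko : k % 2 = 1) (hj : j ≤ k) :
    starGrundy (List.replicate j 2 ++ List.replicate (k - j) 1) =
      if j = 0 then 1
      else if j = 1 then 2
      else if j = 2 then 0
      else if j = 3 then 3
      else if j % 2 = 0 then 1 else 2 := by
  rw [starGrundy, bistarGrundy, bistarGrundyO, bistarVerts_replicate hj, grundy_starVerts,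
    Finset.card_range, Nat.card_Ico, starValue, if_neg (by omega), if_neg (by omega),
    if_pos (by omega)]
  rw [Finset.disjoint_left]
  intro i
  simp only [Finset.mem_range, Finset.mem_Ico]
  omega
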